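/- arXiv:1909.10645 — 9 statements merged into one kernel-verified Lean document; each statement's English description precedes it below -/
import Mathlib

section
/- The proportional allocation rule is the unique allocation rule that is symmetric, strongly budget-balanced, sybil-proof, and weakly collusion-proof under proportional sharing. That is, an allocation rule x satisfies these four properties if and only if x_i(h) = h_i / (\sum_{j=1}^n h_j) for every configuration h of length n and every i. -/
/-- An *allocation rule* maps every configuration (a finite tuple of positive
integer hash rates) of every length to a tuple of nonnegative real
(expected) rewards of the same length. -/
structure AllocRule where
  alloc : ∀ {n : ℕ}, (Fin n → ℕ+) → Fin n → ℝ
  nonneg : ∀ {n : ℕ} (h : Fin n → ℕ+) (i : Fin n), 0 ≤ alloc h i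

/-- A1: symmetry: `x (π h) = π (x h)` for every permutation `π`. -/
def SymmetricRule (x : AllocRule) : Prop :=
  ∀ {n : ℕ}, 0 < n → ∀ (h : Fin n → ℕ+) (π : Equiv.Perm (Fin n)) (i : Fin n),
    x.alloc (h ∘ π) i = x.alloc h (π i)

/-- A2a: strong budget balance. -/
def StronglyBudgetBalanced (x : AllocRule) : Prop :=
  ∀ {n : ℕ}, 0 < n → ∀ h : Fin n → ℕ+, ∑ i, x.alloc h i = 1

/-- A2b: weak budget balance. -/
def WeaklyBudgetBalanced (x : AllocRule) : Prop :=
  ∀ {n : ℕ}, 0 < n → ∀ h : Fin n → ℕ+, ∑ i, x.alloc h i ≤ 1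

/-- `h'` (whose set of new-entry positions is `S`) is obtained from `h` by
replacing the single entry at index `i` with a finite tuple of positive
integers summing to at most `h i`, all other entries unchanged. -/
def IsSybilSplit {n m : ℕ} (h : Fin n → ℕ+) (i : Fin n)
    (h' : Fin m → ℕ+) (S : Finset (Fin m)) : Prop :=
  S.Nonempty ∧
  ∃ e : {j : Fin n // j ≠ i} ↪ Fin m,
    (∀ j, h' (e j) = h j.1) ∧
    (∀ k : Fin m, k ∈ S ↔ k ∉ Set.range e) ∧
    (∑ k ∈ S, (h' k : ℕ)) ≤ (h i : ℕ)

/-- A3: sybil-proofness. -/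
def SybilProof (x : AllocRule) : Prop :=
  ∀ {n m : ℕ}, 0 < n →
    ∀ (h : Fin n → ℕ+) (i : Fin n) (h' : Fin m → ℕ+) (S : Finset (Fin m)),
      IsSybilSplit h i h' S → ∑ j ∈ S, x.alloc h' j ≤ x.alloc h i

/-- `h'` (with merged-miner position `istar`) is obtained from `h` by
replacing the (nonempty) set `T` of miners with a single new miner whose hash
rate is at most the total hash rate of `T`, all other entries unchanged. -/
def IsMerge {n m : ℕ} (h : Fin n → ℕ+) (T : Finset (Fin n))
    (h' : Fin m → ℕ+) (istar : Fin m) : Prop :=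
  T.Nonempty ∧
  ∃ e : {j : Fin n // j ∉ T} ↪ Fin m,
    (∀ j, h' (e j) = h j.1) ∧
    (∀ k : Fin m, k = istar ↔ k ∉ Set.range e) ∧
    (h' istar : ℕ) ≤ ∑ j ∈ T, (h j : ℕ)

/-- A4a: collusion-proofness under arbitrary reward sharing. -/
def CollusionProofArbitrary (x : AllocRule) : Prop :=
  ∀ {n m : ℕ}, 0 < n →
    ∀ (h : Fin n → ℕ+) (T : Finset (Fin n)) (h' : Fin m → ℕ+) (istar : Fin m),
      IsMerge h T h' istar → x.alloc h' istar ≤ ∑ j ∈ T, x.alloc h j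

/-- A4b: strong collusion-proofness under proportional sharing. -/
def StronglyCollusionProof (x : AllocRule) : Prop :=
  ∀ {n m : ℕ}, 0 < n →
    ∀ (h : Fin n → ℕ+) (T : Finset (Fin n)) (h' : Fin m → ℕ+) (istar : Fin m),
      IsMerge h T h' istar →
      (∃ i ∈ T, x.alloc h i <
        x.alloc h' istar * (((h i : ℕ) : ℝ) / ∑ j ∈ T, ((h j : ℕ) : ℝ))) →
      ∃ l ∈ T, x.alloc h' istar * (((h l : ℕ) : ℝ) / ∑ j ∈ T, ((h j : ℕ) : ℝ))
        < x.alloc h l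

/-- A4c: weak collusion-proofness under proportional sharing. -/
def WeaklyCollusionProof (x : AllocRule) : Prop :=
  ∀ {n m : ℕ}, 0 < n →
    ∀ (h : Fin n → ℕ+) (T : Finset (Fin n)) (h' : Fin m → ℕ+) (istar : Fin m),
      IsMerge h T h' istar →
      ∃ i ∈ T, x.alloc h' istar * (((h i : ℕ) : ℝ) / ∑ j ∈ T, ((h j : ℕ) : ℝ))
        ≤ x.alloc h i

/-- Bitcoin's proportional allocation rule. -/
noncomputable def propRule : AllocRule where
  alloc := fun {n} h i => ((h i : ℕ) : ℝ) / ∑ j, ((h j : ℕ) : ℝ)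
  nonneg := fun h i => div_nonneg (Nat.cast_nonneg _)
    (Finset.sum_nonneg fun j _ => Nat.cast_nonneg _)

open Finset

/-- The total of a configuration `g` that contains, through `e`, the entries of `h` satisfying `p`
and whose other positions form `S`. -/
lemma sum_eq_sum_add_sum_of_embedding {n m : ℕ} {p : Fin n → Prop} [DecidablePred p]
    {h : Fin n → ℕ+} {g : Fin m → ℕ+} {S : Finset (Fin m)} (e : {j : Fin n // p j} ↪ Fin m)
    (he : ∀ j, g (e j) = h j.1) (hS : ∀ k, k ∈ S ↔ k ∉ Set.range e) :
    ∑ k, (g k : ℕ) = ∑ k ∈ S, (g k : ℕ) + ∑ j : {j : Fin n // p j}, (h j.1 : ℕ) := by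
  have hc : Sᶜ = univ.map e := by
    ext k
    simp [hS]
  rw [← sum_add_sum_compl S, hc, sum_map]
  simp [he]

lemma div_add_self_le_div_add_self {a b r : ℝ} (ha : 0 < a) (hr : 0 ≤ r) (hab : a ≤ b) :
    a / (r + a) ≤ b / (r + b) := by
  rw [div_le_div_iff₀ (by linarith) (by linarith)]
  nlinarith

lemma sum_coe_pos {n : ℕ} (h : Fin n → ℕ+) {T : Finset (Fin n)} (hT : T.Nonempty) :
    0 < ∑ j ∈ T, (h j : ℕ) :=
  sum_pos (fun j _ => (h j).pos) hT

lemma IsSybilSplit.div_sum_le {n m : ℕ} {h : Fin n → ℕ+} {i : Fin n} {g : Fin m → ℕ+}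
    {S : Finset (Fin m)} (H : IsSybilSplit h i g S) :
    (∑ j ∈ S, ((g j : ℕ) : ℝ)) / ∑ j, ((g j : ℕ) : ℝ) ≤
      ((h i : ℕ) : ℝ) / ∑ j, ((h j : ℕ) : ℝ) := by
  obtain ⟨hS, e, he, hSe, hle⟩ := H
  have h₁ := sum_eq_sum_add_sum_of_embedding e he hSe
  have h₂ : ∑ j, (h j : ℕ) = (h i : ℕ) + ∑ j : {j : Fin n // j ≠ i}, (h j.1 : ℕ) :=
    Fintype.sum_eq_add_sum_subtype_ne _ i
  have hpos := sum_coe_pos g hS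
  rify at h₁ h₂ hle hpos
  rw [h₁, h₂, add_comm, add_comm (((h i : ℕ) : ℝ))]
  exact div_add_self_le_div_add_self hpos (by positivity) hle

lemma IsMerge.div_sum_le {n m : ℕ} {h : Fin n → ℕ+} {T : Finset (Fin n)} {g : Fin m → ℕ+}
    {k : Fin m} (H : IsMerge h T g k) :
    ((g k : ℕ) : ℝ) / ∑ j, ((g j : ℕ) : ℝ) ≤
      (∑ j ∈ T, ((h j : ℕ) : ℝ)) / ∑ j, ((h j : ℕ) : ℝ) := by
  obtain ⟨hT, e, he, hke, hle⟩ := H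
  have h₁ := sum_eq_sum_add_sum_of_embedding (S := {k}) e he (by simpa using hke)
  have h₂ : ∑ j, (h j : ℕ) = ∑ j ∈ T, (h j : ℕ) + ∑ j : {j : Fin n // j ∉ T}, (h j.1 : ℕ) := by
    rw [← sum_add_sum_compl T]
    congr 1
    exact (sum_subtype _ (by simp) _)
  rw [sum_singleton] at h₁
  have hpos := (g k).pos
  rify at h₁ h₂ hle hpos
  rw [h₁, h₂, add_comm, add_comm (∑ j ∈ T, ((h j : ℕ) : ℝ))]
  exact div_add_self_le_div_add_self hpos (by positivity) hle

/-- Any entry of a configuration can be split into ones, and the split can be undone by merging. -/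
lemma exists_split_into_ones {n : ℕ} (h : Fin n → ℕ+) (i : Fin n) :
    ∃ (m : ℕ) (g : Fin m → ℕ+) (S : Finset (Fin m)), m + 1 = n + h i ∧ #S = h i ∧
      (∀ k ∈ S, g k = 1) ∧ ∑ k, (g k : ℕ) = ∑ j, (h j : ℕ) ∧
      IsSybilSplit h i g S ∧ IsMerge g S h i := by
  classical
  let E := Fintype.equivFin ({j : Fin n // j ≠ i} ⊕ Fin (h i))
  let f : {j : Fin n // j ≠ i} ⊕ Fin (h i) → ℕ+ := Sum.elim (fun j => h j.1) (fun _ => 1)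
  let S : Finset (Fin _) := univ.map (Function.Embedding.inr.trans E.toEmbedding)
  have hS : ∀ a, E a ∈ S ↔ a.isRight := by
    rintro (a | a) <;> simp [S]
  have hinl : ∀ k ∉ S, ∃ a, k = E (.inl a) := by
    intro k hk
    obtain ⟨a | a, rfl⟩ := E.surjective k
    · exact ⟨a, rfl⟩
    · simp [hS] at hk
  have hcard : #S = h i := by simp [S]
  have hone : ∀ k ∈ S, (f ∘ E.symm) k = 1 := by
    intro k
    obtain ⟨a | a, rfl⟩ := E.surjective k <;> simp [hS, f]
  have hsumS : ∑ k ∈ S, ((f ∘ E.symm) k : ℕ) = h i := by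
    rw [sum_congr rfl fun k hk => by rw [hone k hk]]
    simp [hcard]
  have hne : S.Nonempty := by
    rw [← card_pos, hcard]
    exact (h i).pos
  have hsplit : IsSybilSplit h i (f ∘ E.symm) S := by
    refine ⟨hne, Function.Embedding.inl.trans E.toEmbedding, fun j => by simp [f], fun k => ?_,
      hsumS.le⟩
    obtain ⟨a | a, rfl⟩ := E.surjective k <;> simp [hS]
  let v : {k // k ∉ S} → Fin n := fun k => Sum.elim (fun j => j.1) (fun _ => i) (E.symm k.1)
  have hv : ∀ a hk, v ⟨E (.inl a), hk⟩ = a.1 := fun a hk => by simp [v]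
  have hinj : v.Injective := by
    rintro ⟨k, hk⟩ ⟨l, hl⟩ hkl
    obtain ⟨a, rfl⟩ := hinl k hk
    obtain ⟨b, rfl⟩ := hinl l hl
    rw [hv, hv] at hkl
    rw [Subtype.mk_eq_mk, Subtype.ext hkl]
  refine ⟨_, f ∘ E.symm, S, ?_, hcard, hone, ?_, hsplit, hne, ⟨v, hinj⟩, ?_, ?_, hsumS.ge⟩
  · have := i.pos
    simp
    omega
  · obtain ⟨-, e, he, hSe, -⟩ := hsplit
    rw [sum_eq_sum_add_sum_of_embedding e he hSe, hsumS]
    exact (Fintype.sum_eq_add_sum_subtype_ne (fun j => (h j : ℕ)) i).symm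
  · rintro ⟨k, hk⟩
    obtain ⟨a, rfl⟩ := hinl k hk
    rw [Function.Embedding.coeFn_mk, hv]
    simp [f]
  · intro k
    rw [Function.Embedding.coeFn_mk]
    constructor
    · rintro rfl ⟨⟨l, hl⟩, hlk⟩
      obtain ⟨a, rfl⟩ := hinl l hl
      exact a.2 (by rwa [hv] at hlk)
    · intro hk
      by_contra hki
      exact hk ⟨⟨E (.inl ⟨k, hki⟩), by simp [hS]⟩, hv _ _⟩

lemma SymmetricRule.alloc_eq_of_eq {x : AllocRule} (hx : SymmetricRule x) {n : ℕ}
    {h : Fin n → ℕ+} {i j : Fin n} (hij : h i = h j) : x.alloc h i = x.alloc h j := by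
  have hh : h ∘ Equiv.swap i j = h := by
    ext k
    rcases eq_or_ne k i with rfl | hi
    · simp [hij]
    rcases eq_or_ne k j with rfl | hj
    · simp [hij]
    simp [Equiv.swap_apply_of_ne_of_ne hi hj]
  simpa [hh] using hx i.pos h (Equiv.swap i j) i

lemma alloc_eq_div_sum {x : AllocRule} (hsym : SymmetricRule x) (hbal : StronglyBudgetBalanced x)
    (hsyb : SybilProof x) (hcol : WeaklyCollusionProof x) {n : ℕ} (h : Fin n → ℕ+) (i : Fin n) :
    x.alloc h i = ((h i : ℕ) : ℝ) / ∑ j, ((h j : ℕ) : ℝ) := by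
  induction hd : ∑ j, (h j : ℕ) - n using Nat.strong_induction_on generalizing n with
  | _ d ih =>
  have key : ∀ k, h k ≠ 1 → x.alloc h k = ((h k : ℕ) : ℝ) / ∑ j, ((h j : ℕ) : ℝ) := by
    intro k hk
    obtain ⟨m, g, S, hm, hcard, hone, hsum, hsplit, hmerge⟩ := exists_split_into_ones h k
    have hk1 : 1 < (h k : ℕ) := by
      have := (h k).pos
      have : (h k : ℕ) ≠ 1 := fun H => hk (PNat.coe_eq_one_iff.mp H)
      omega
    have hmle : m ≤ ∑ j, (g j : ℕ) := by
      simpa using card_nsmul_le_sum univ (fun j => (g j : ℕ)) 1 fun j _ => (g j).pos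
    have hg : ∀ j ∈ S, x.alloc g j = 1 / ∑ j, ((h j : ℕ) : ℝ) := by
      intro j hj
      rw [ih _ (by omega) g j rfl, hone j hj]
      congr 1
      · simp
      · exact_mod_cast hsum
    have hsumS : ∑ j ∈ S, ((g j : ℕ) : ℝ) = (h k : ℕ) := by
      rw [sum_congr rfl fun j hj => by rw [hone j hj]]
      simp [hcard]
    apply le_antisymm
    · obtain ⟨j, hj, hle⟩ := hcol (by omega) g S h k hmerge
      rw [hsumS, hone j hj, hg j hj] at hle
      have hpos : (0 : ℝ) < (h k : ℕ) := by exact_mod_cast (h k).pos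
      simp only [PNat.one_coe, Nat.cast_one, mul_one_div] at hle
      rw [div_le_iff₀ hpos] at hle
      exact hle.trans_eq (by ring)
    · have hle := hsyb k.pos h k g S hsplit
      rw [sum_congr rfl hg, sum_const, hcard, nsmul_eq_mul, mul_one_div] at hle
      exact hle
  by_cases hi : h i = 1
  · have hpos : (0 : ℝ) < ∑ j, ((h j : ℕ) : ℝ) := by
      exact_mod_cast sum_coe_pos h ⟨i, mem_univ i⟩
    have hzero : ∑ j, (x.alloc h j - ((h j : ℕ) : ℝ) / ∑ l, ((h l : ℕ) : ℝ)) = 0 := by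
      rw [sum_sub_distrib, hbal i.pos, ← sum_div, div_self hpos.ne', sub_self]
    have hterm : ∀ j, x.alloc h j - ((h j : ℕ) : ℝ) / ∑ l, ((h l : ℕ) : ℝ) =
        if h j = 1 then x.alloc h i - ((h i : ℕ) : ℝ) / ∑ l, ((h l : ℕ) : ℝ) else 0 := by
      intro j
      split_ifs with hj
      · rw [hsym.alloc_eq_of_eq (hj.trans hi.symm), hj, hi]
      · rw [key j hj, sub_self]
    rw [sum_congr rfl fun j _ => hterm j, ← sum_filter, sum_const, smul_eq_zero] at hzero
    refine sub_eq_zero.mp (hzero.resolve_left ?_)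
    exact card_ne_zero_of_mem (mem_filter.mpr ⟨mem_univ i, hi⟩)
  · exact key i hi

/-- Theorem 1: the proportional allocation rule is the unique
allocation rule that is symmetric, strongly budget-balanced, sybil-proof, and
weakly collusion-proof under proportional sharing. -/
theorem proportional_characterization (x : AllocRule) :
    (SymmetricRule x ∧ StronglyBudgetBalanced x ∧ SybilProof x ∧
      WeaklyCollusionProof x) ↔
    (∀ (n : ℕ), 0 < n → ∀ (h : Fin n → ℕ+) (i : Fin n),
      x.alloc h i = ((h i : ℕ) : ℝ) / ∑ j, ((h j : ℕ) : ℝ)) := by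
  constructor
  · rintro ⟨hsym, hbal, hsyb, hcol⟩ n - h i
    exact alloc_eq_div_sum hsym hbal hsyb hcol h i
  · intro hx
    refine ⟨fun {n} hn h π i => ?_, fun {n} hn h => ?_, fun {n m} hn h i g S H => ?_,
      fun {n m} hn h T g k H => ?_⟩
    · rw [hx n hn, hx n hn]
      congr 1
      exact Equiv.sum_comp π fun j => ((h j : ℕ) : ℝ)
    · have hpos : (0 : ℝ) < ∑ j, ((h j : ℕ) : ℝ) := by
        exact_mod_cast sum_coe_pos h ⟨⟨0, hn⟩, mem_univ _⟩
      rw [sum_congr rfl fun j _ => hx n hn h j, ← sum_div, div_self hpos.ne']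
    · obtain ⟨k, -⟩ := H.1
      rw [sum_congr rfl fun j _ => hx m k.pos g j, ← sum_div, hx n hn]
      exact H.div_sum_le
    · obtain ⟨j, hj⟩ := H.1
      refine ⟨j, hj, ?_⟩
      have hpos : (0 : ℝ) < ∑ l ∈ T, ((h l : ℕ) : ℝ) := by
        exact_mod_cast sum_coe_pos h H.1
      rw [hx m k.pos, hx n hn]
      calc _ ≤ (∑ l ∈ T, ((h l : ℕ) : ℝ)) / (∑ l, ((h l : ℕ) : ℝ)) *
            (((h j : ℕ) : ℝ) / ∑ l ∈ T, ((h l : ℕ) : ℝ)) := by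
            exact mul_le_mul_of_nonneg_right H.div_sum_le (by positivity)
        _ = _ := by field_simp
end

section
/- The proportional allocation rule is sybil-proof: for every configuration h of length n, every index i, and every configuration h' obtained from h by replacing the single entry h_i with a finite tuple of positive integers summing to at most h_i (all other entries unchanged), the total proportional reward of the new entries under h' is at most the proportional reward h_i / (∑_{j=1}^n h_j) of miner i under h. -/
theorem div_add_le_div_add_of_le {a b c : ℝ} (ha : 0 < a) (hb : 0 ≤ b) (hac : a ≤ c) :
    a / (a + b) ≤ c / (c + b) := by
  rw [div_le_div_iff₀ (by linarith) (by linarith)]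
  nlinarith [mul_le_mul_of_nonneg_right hac hb]

/-- the proportional allocation rule is sybil-proof. -/
theorem propRule_sybilProof : SybilProof propRule := by
  intro n m _ h i h' S hS
  obtain ⟨⟨k, hk⟩, e, he, hmem, hle⟩ := hS
  have hcompl : Sᶜ = Finset.univ.map e := by
    ext j
    simp [hmem]
  have hsum' : ∑ j, ((h' j : ℕ) : ℝ) =
      ∑ j ∈ S, ((h' j : ℕ) : ℝ) + ∑ j : {j : Fin n // j ≠ i}, ((h j : ℕ) : ℝ) := by
    rw [← Finset.sum_add_sum_compl S, hcompl, Finset.sum_map]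
    simp only [he]
  have hsum : ∑ j, ((h j : ℕ) : ℝ) =
      ((h i : ℕ) : ℝ) + ∑ j : {j : Fin n // j ≠ i}, ((h j : ℕ) : ℝ) :=
    Fintype.sum_eq_add_sum_subtype_ne (fun j => ((h j : ℕ) : ℝ)) i
  simp only [propRule]
  rw [← Finset.sum_div, hsum', hsum]
  refine div_add_le_div_add_of_le ?_ ?_ (by exact_mod_cast hle)
  · exact Finset.sum_pos (fun j _ => Nat.cast_pos.mpr (h' j).pos) ⟨k, hk⟩
  · exact Finset.sum_nonneg fun j _ => Nat.cast_nonneg _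
end

section
/- The proportional allocation rule is collusion-proof under arbitrary reward sharing: for every configuration h of length n, every nonempty subset T ⊆ {1,…,n}, and every configuration h' obtained from h by replacing the entries indexed by T with a single new entry i* whose hash rate is at most ∑_{j∈T} h_j (all other entries unchanged), the proportional reward of the merged miner i* under h' is at most ∑_{j∈T} h_j / (∑_{j=1}^n h_j). -/
/-- The total hash rate after a merge is the rate of the merged miner plus the rates of the
miners outside the merging set. -/
theorem IsMerge.sum_eq {n m : ℕ} {h : Fin n → ℕ+} {T : Finset (Fin n)} {h' : Fin m → ℕ+}
    {istar : Fin m} (hmerge : IsMerge h T h' istar) :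
    ∑ k, ((h' k : ℕ) : ℝ) = ((h' istar : ℕ) : ℝ) + ∑ j ∈ Tᶜ, ((h j : ℕ) : ℝ) := by
  obtain ⟨-, e, he, hrange, -⟩ := hmerge
  have hmap : Finset.univ.erase istar = Finset.univ.map e := by
    ext k
    have := hrange k
    simp only [Set.mem_range] at this
    simp [this]
  rw [← Finset.add_sum_erase _ _ (Finset.mem_univ istar), hmap, Finset.sum_map]
  simp only [he]
  rw [Finset.sum_subtype Tᶜ (p := fun j => j ∉ T) (fun j => Finset.mem_compl)]

/-- the proportional allocation rule is collusion-proof under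
arbitrary reward sharing: the proportional reward of the merged miner `i*`
under `h'` is at most `(∑_{j ∈ T} h_j) / (∑_{j=1}^n h_j)`. -/
theorem propRule_collusionProof {n m : ℕ} (hn : 0 < n)
    (h : Fin n → ℕ+) (T : Finset (Fin n)) (h' : Fin m → ℕ+) (istar : Fin m)
    (hmerge : IsMerge h T h' istar) :
    propRule.alloc h' istar ≤ (∑ j ∈ T, ((h j : ℕ) : ℝ)) / ∑ j, ((h j : ℕ) : ℝ) := by
  have hsum := hmerge.sum_eq
  obtain ⟨-, -, -, -, hle⟩ := hmerge
  have hle' : ((h' istar : ℕ) : ℝ) ≤ ∑ j ∈ T, ((h j : ℕ) : ℝ) := by exact_mod_cast hle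
  have hpos : (0 : ℝ) < ((h' istar : ℕ) : ℝ) := Nat.cast_pos.mpr (h' istar).pos
  have hrest : (0 : ℝ) ≤ ∑ j ∈ Tᶜ, ((h j : ℕ) : ℝ) :=
    Finset.sum_nonneg fun j _ => Nat.cast_nonneg _
  change ((h' istar : ℕ) : ℝ) / ∑ k, ((h' k : ℕ) : ℝ) ≤ _
  rw [hsum, ← Finset.sum_add_sum_compl T, div_le_div_iff₀ (by linarith) (by linarith)]
  nlinarith [mul_le_mul_of_nonneg_right hle' hrest]
end

section
/- For every nondecreasing function c : ℕ → [0,1], the generalized proportional allocation rule with coefficient c is sybil-proof: for every configuration h of length n, every index i, and every configuration h' obtained from h by replacing the single entry h_i with a finite tuple of positive integers summing to at most h_i (all other entries unchanged), the sum over the set S of indices of the new entries satisfies ∑_{j∈S} x_j(h') ≤ x_i(h). -/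
/-- The generalized proportional allocation rule with coefficient `c`. -/
noncomputable def genPropRule (c : ℕ → ℝ) (hc : ∀ k, 0 ≤ c k) : AllocRule where
  alloc := fun {n} h i => c (∑ j, (h j : ℕ)) *
    (((h i : ℕ) : ℝ) / ∑ j, ((h j : ℕ) : ℝ))
  nonneg := fun h i => mul_nonneg (hc _) (div_nonneg (Nat.cast_nonneg _)
    (Finset.sum_nonneg fun j _ => Nat.cast_nonneg _))


/-- Totals of both configurations share the summand contributed by the unchanged entries. -/
lemma IsSybilSplit.exists_rest {n m : ℕ} {h : Fin n → ℕ+} {i : Fin n}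
    {h' : Fin m → ℕ+} {S : Finset (Fin m)} (hs : IsSybilSplit h i h' S) :
    ∃ r : ℕ, ∑ j, (h j : ℕ) = h i + r ∧
      ∑ k, (h' k : ℕ) = ∑ k ∈ S, (h' k : ℕ) + r := by
  obtain ⟨-, e, he, hS, -⟩ := hs
  have hcompl : Sᶜ = Finset.univ.map e := by
    ext k
    simp [hS]
  refine ⟨∑ j : {j : Fin n // j ≠ i}, (h j : ℕ), ?_, ?_⟩
  · exact Fintype.sum_eq_add_sum_subtype_ne (fun j => (h j : ℕ)) i
  · rw [← Finset.sum_add_sum_compl S, hcompl, Finset.sum_map]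
    simp only [he]

lemma div_add_le_div_add_of_le_s4 {s a r : ℝ} (hs : 0 < s) (hsa : s ≤ a) (hr : 0 ≤ r) :
    s / (s + r) ≤ a / (a + r) := by
  rw [div_le_div_iff₀ (by linarith) (by linarith)]
  nlinarith

/-- for every nondecreasing `c : ℕ → [0,1]`, the generalized
proportional allocation rule with coefficient `c` is sybil-proof. -/
theorem genPropRule_sybilProof (c : ℕ → ℝ) (hc0 : ∀ k, 0 ≤ c k)
    (hc1 : ∀ k, c k ≤ 1) (hmono : Monotone c) :
    SybilProof (genPropRule c hc0) := by
  intro n m _ h i h' S hs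
  obtain ⟨r, hr, hr'⟩ := hs.exists_rest
  obtain ⟨hne, -, -, -, hle⟩ := hs
  have hpos : 0 < ∑ k ∈ S, (h' k : ℕ) := Finset.sum_pos (fun k _ => (h' k).pos) hne
  simp only [genPropRule, ← Finset.mul_sum, ← Finset.sum_div, ← Nat.cast_sum, hr, hr']
  simp only [Nat.cast_add]
  gcongr ?_ * ?_
  · exact hc0 _
  · exact hmono (by lia)
  · exact div_add_le_div_add_of_le_s4 (mod_cast hpos) (mod_cast hle) r.cast_nonneg
end

section
/- For every nondecreasing function c : ℕ → [0,1], the generalized proportional allocation rule with coefficient c is collusion-proof under arbitrary reward sharing: for every configuration h of length n, every nonempty subset T ⊆ {1,…,n}, and every configuration h' obtained from h by replacing the entries indexed by T with a single new entry i* whose hash rate is at most ∑_{j∈T} h_j (all other entries unchanged), one has x_{i*}(h') ≤ ∑_{j∈T} x_j(h). -/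
/-- The total hash rate splits into that of `T` and that of its complement. -/
theorem sum_compl_subtype_add_sum {n : ℕ} (f : Fin n → ℕ) (T : Finset (Fin n)) :
    ∑ j : {j : Fin n // j ∉ T}, f j + ∑ j ∈ T, f j = ∑ j, f j := by
  rw [← Finset.sum_compl_add_sum T f,
    Finset.sum_subtype Tᶜ (p := fun j => j ∉ T) (fun _ => Finset.mem_compl) f]

/-- If `e` embeds a finite type into `Fin m` and misses exactly `k₀`, then a sum over `Fin m`
is the term at `k₀` plus the sum along `e`. -/
theorem sum_eq_sum_embedding_add {ι : Type*} [Fintype ι] {m : ℕ} (f : Fin m → ℕ)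
    (e : ι ↪ Fin m) (k₀ : Fin m) (he : ∀ k, k = k₀ ↔ k ∉ Set.range e) :
    ∑ k, f k = ∑ j, f (e j) + f k₀ := by
  have hmap : Finset.univ.map e = {k₀}ᶜ := by
    ext k
    have := he k
    simp only [Set.mem_range] at this
    simp only [Finset.mem_map, Finset.mem_univ, true_and, Finset.mem_compl,
      Finset.mem_singleton]
    tauto
  rw [← Finset.sum_compl_add_sum {k₀} f, ← hmap, Finset.sum_map, Finset.sum_singleton]

/-- With the rest of the network held fixed at `r`, the reward share is monotone. -/
theorem div_add_le_div_add {r a b : ℝ} (hr : 0 ≤ r) (ha : 0 < a) (hab : a ≤ b) :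
    a / (r + a) ≤ b / (r + b) := by
  rw [div_le_div_iff₀ (by linarith) (by linarith)]
  nlinarith

/-- for every nondecreasing `c : ℕ → [0,1]`, the generalized
proportional allocation rule with coefficient `c` is collusion-proof under
arbitrary reward sharing. -/
theorem genPropRule_collusionProofArbitrary (c : ℕ → ℝ) (hc0 : ∀ k, 0 ≤ c k)
    (hc1 : ∀ k, c k ≤ 1) (hmono : Monotone c) :
    CollusionProofArbitrary (genPropRule c hc0) := by
  intro n m _ h T h' istar ⟨_, e, heq, hrange, hle⟩
  have hsum' := sum_eq_sum_embedding_add (fun k => (h' k : ℕ)) e istar hrange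
  have hsum := sum_compl_subtype_add_sum (fun j => (h j : ℕ)) T
  simp only [heq] at hsum'
  simp only [genPropRule, ← Finset.mul_sum, ← Finset.sum_div, ← Nat.cast_sum]
  rw [hsum', ← hsum]
  refine mul_le_mul (hmono (by gcongr)) ?_ (by positivity) (hc0 _)
  rw [Nat.cast_add, Nat.cast_add]
  exact div_add_le_div_add (Nat.cast_nonneg _) (Nat.cast_pos.mpr (h' istar).pos)
    (Nat.cast_le.mpr hle)
end

section
/- The proportional-to-squares allocation rule, defined by x_i(h) = h_i² / ∑_{j=1}^n h_j², is symmetric, strongly budget-balanced, and sybil-proof. -/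
/-- The proportional-to-squares allocation rule. -/
noncomputable def sqRule : AllocRule where
  alloc := fun {n} h i => ((h i : ℕ) : ℝ) ^ 2 / ∑ j, ((h j : ℕ) : ℝ) ^ 2
  nonneg := fun h i => div_nonneg (by positivity)
    (Finset.sum_nonneg fun j _ => by positivity)


theorem sqRule_symmetric : SymmetricRule sqRule := by
  intro n _ h π i
  simp only [sqRule, Function.comp_apply]
  rw [Equiv.sum_comp π (fun j => ((h j : ℕ) : ℝ) ^ 2)]

theorem sum_sq_pos {n : ℕ} (hn : 0 < n) (h : Fin n → ℕ+) :
    0 < ∑ j, ((h j : ℕ) : ℝ) ^ 2 :=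
  Finset.sum_pos (fun j _ => pow_pos (Nat.cast_pos.mpr (h j).pos) 2) ⟨⟨0, hn⟩, Finset.mem_univ _⟩

theorem sqRule_stronglyBudgetBalanced : StronglyBudgetBalanced sqRule := by
  intro n hn h
  simp only [sqRule]
  rw [← Finset.sum_div, div_self (sum_sq_pos hn h).ne']

/-- A sybil split leaves the total of any weight over the other entries unchanged. -/
theorem IsSybilSplit.sum_compl_eq {n m : ℕ} {h : Fin n → ℕ+} {i : Fin n}
    {h' : Fin m → ℕ+} {S : Finset (Fin m)} (hs : IsSybilSplit h i h' S) (f : ℕ+ → ℝ) :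
    ∑ k ∈ Sᶜ, f (h' k) = ∑ j ∈ {i}ᶜ, f (h j) := by
  obtain ⟨-, e, he, hS, -⟩ := hs
  have hmap : Sᶜ = Finset.univ.map e := by
    ext k
    simp [hS]
  rw [hmap, Finset.sum_map,
    Finset.sum_subtype (p := fun j => j ≠ i) ({i}ᶜ) (by simp) (fun j => f (h j))]
  exact Finset.sum_congr rfl fun j _ => by rw [he]

theorem sqRule_sybilProof : SybilProof sqRule := by
  intro n m _ h i h' S hs
  have hcompl := hs.sum_compl_eq (fun a => ((a : ℕ) : ℝ) ^ 2)
  obtain ⟨⟨k, hk⟩, -, -, -, hle⟩ := hs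
  simp only [sqRule]
  rw [← Finset.sum_div, ← Finset.sum_add_sum_compl S, ← Finset.sum_add_sum_compl {i},
    Finset.sum_singleton, hcompl]
  have hB : 0 ≤ ∑ j ∈ {i}ᶜ, ((h j : ℕ) : ℝ) ^ 2 := Finset.sum_nonneg fun j _ => by positivity
  have hA : 0 < ∑ k ∈ S, ((h' k : ℕ) : ℝ) ^ 2 :=
    Finset.sum_pos (fun j _ => pow_pos (Nat.cast_pos.mpr (h' j).pos) 2) ⟨k, hk⟩
  have hAc : ∑ k ∈ S, ((h' k : ℕ) : ℝ) ^ 2 ≤ ((h i : ℕ) : ℝ) ^ 2 := by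
    refine (Finset.sum_sq_le_sq_sum_of_nonneg fun j _ => Nat.cast_nonneg _).trans ?_
    gcongr
    exact_mod_cast hle
  rw [div_le_div_iff₀ (by positivity) (by linarith)]
  nlinarith

/-- the proportional-to-squares allocation rule is symmetric,
strongly budget-balanced, and sybil-proof. -/
theorem sqRule_props :
    SymmetricRule sqRule ∧ StronglyBudgetBalanced sqRule ∧ SybilProof sqRule := by
  exact ⟨sqRule_symmetric, sqRule_stronglyBudgetBalanced, sqRule_sybilProof⟩
end

section
/- The proportional-to-squares allocation rule, defined by x_i(h) = h_i² / ∑_{j=1}^n h_j², is not weakly collusion-proof under proportional sharing. -/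
/-- the proportional-to-squares allocation rule is not weakly
collusion-proof under proportional sharing. -/
theorem sqRule_not_weaklyCollusionProof : ¬ WeaklyCollusionProof sqRule := by
  intro hx
  have hm : IsMerge (n := 3) (m := 2) ![1, 1, 1] {0, 1} ![2, 1] 0 := by
    have eq_two : ∀ j : Fin 3, j ∉ ({0, 1} : Finset (Fin 3)) → j = 2 := by decide
    refine ⟨⟨0, by simp⟩, ⟨fun _ => 1, ?_⟩, ?_, ?_, ?_⟩
    · rintro ⟨a, ha⟩ ⟨b, hb⟩ _
      exact Subtype.ext ((eq_two a ha).trans (eq_two b hb).symm)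
    · rintro ⟨a, ha⟩
      obtain rfl := eq_two a ha
      rfl
    · intro k
      change k = 0 ↔ ¬ ∃ _ : {j : Fin 3 // j ∉ ({0, 1} : Finset (Fin 3))}, (1 : Fin 2) = k
      rw [exists_const_iff, and_iff_right ⟨⟨2, by decide⟩⟩]
      revert k
      decide
    · simp
  obtain ⟨i, hi, hle⟩ := hx (by norm_num) _ _ _ _ hm
  fin_cases i <;> simp [sqRule, Fin.sum_univ_succ] at hi hle <;> norm_num at hle
end

section
/- The proportional-to-square-roots allocation rule, defined by x_i(h) = √h_i / ∑_{j=1}^n √h_j, is symmetric, strongly budget-balanced, and collusion-proof under arbitrary reward sharing. -/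
/-- The proportional-to-square-roots allocation rule. -/
noncomputable def sqrtRule : AllocRule where
  alloc := fun {n} h i =>
    Real.sqrt ((h i : ℕ) : ℝ) / ∑ j, Real.sqrt ((h j : ℕ) : ℝ)
  nonneg := fun h i => div_nonneg (Real.sqrt_nonneg _)
    (Finset.sum_nonneg fun j _ => Real.sqrt_nonneg _)


/-- The square root is subadditive over finite sums of nonnegative reals. -/
theorem sqrt_sum_le_sum_sqrt {ι : Type*} (s : Finset ι) (f : ι → ℝ) (hf : ∀ i, 0 ≤ f i) :
    Real.sqrt (∑ i ∈ s, f i) ≤ ∑ i ∈ s, Real.sqrt (f i) := by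
  have hsum : 0 ≤ ∑ i ∈ s, Real.sqrt (f i) := Finset.sum_nonneg fun i _ => Real.sqrt_nonneg _
  rw [Real.sqrt_le_left hsum]
  calc ∑ i ∈ s, f i = ∑ i ∈ s, Real.sqrt (f i) ^ 2 :=
        Finset.sum_congr rfl fun i _ => (Real.sq_sqrt (hf i)).symm
    _ ≤ (∑ i ∈ s, Real.sqrt (f i)) ^ 2 :=
        Finset.sum_sq_le_sq_sum_of_nonneg fun i _ => Real.sqrt_nonneg _

/-- A sum over `Fin m` splits into the term at `istar` and the terms indexed by an embedding
whose range is the complement of `istar`. -/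
theorem sum_eq_add_sum_of_range_compl {n m : ℕ} (T : Finset (Fin n)) (istar : Fin m)
    (e : {j : Fin n // j ∉ T} ↪ Fin m) (he : ∀ k : Fin m, k = istar ↔ k ∉ Set.range e)
    (f : Fin m → ℝ) (g : Fin n → ℝ) (hfg : ∀ j, f (e j) = g j.1) :
    ∑ k, f k = f istar + ∑ j ∈ Tᶜ, g j := by
  have hmap : Finset.univ.erase istar = Finset.univ.map e := by
    ext k
    have := he k
    simp only [Set.mem_range] at this
    simp only [Finset.mem_erase, Finset.mem_univ, and_true, Finset.mem_map, true_and, ne_eq]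
    tauto
  have hsub : ∑ j ∈ Tᶜ, g j = ∑ j : {j : Fin n // j ∉ T}, g j.1 :=
    Finset.sum_subtype _ (fun _ => Finset.mem_compl) g
  rw [← Finset.add_sum_erase _ _ (Finset.mem_univ istar), hmap, Finset.sum_map, hsub]
  simp only [hfg]

theorem sqrt_pnat_pos (a : ℕ+) : 0 < Real.sqrt ((a : ℕ) : ℝ) :=
  Real.sqrt_pos.mpr (Nat.cast_pos.mpr a.pos)

theorem symmetricRule_sqrtRule : SymmetricRule sqrtRule := by
  intro n _ h π i
  simp only [sqrtRule, Function.comp_apply]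
  rw [Equiv.sum_comp π fun j => Real.sqrt ((h j : ℕ) : ℝ)]

theorem stronglyBudgetBalanced_sqrtRule : StronglyBudgetBalanced sqrtRule := by
  intro n hn h
  have : Nonempty (Fin n) := ⟨⟨0, hn⟩⟩
  simp only [sqrtRule]
  rw [← Finset.sum_div]
  exact div_self (Finset.sum_pos (fun j _ => sqrt_pnat_pos (h j)) Finset.univ_nonempty).ne'

theorem collusionProofArbitrary_sqrtRule : CollusionProofArbitrary sqrtRule := by
  rintro n m _ h T h' istar ⟨-, e, heq, he, hle⟩
  simp only [sqrtRule]
  rw [← Finset.sum_div, ← Finset.sum_add_sum_compl T,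
    sum_eq_add_sum_of_range_compl T istar e he (fun k => Real.sqrt ((h' k : ℕ) : ℝ))
      (fun j => Real.sqrt ((h j : ℕ) : ℝ)) (fun j => by rw [heq])]
  have hpos := sqrt_pnat_pos (h' istar)
  have hrest : 0 ≤ ∑ j ∈ Tᶜ, Real.sqrt ((h j : ℕ) : ℝ) :=
    Finset.sum_nonneg fun j _ => Real.sqrt_nonneg _
  have hmerge : Real.sqrt ((h' istar : ℕ) : ℝ) ≤ ∑ j ∈ T, Real.sqrt ((h j : ℕ) : ℝ) :=
    (Real.sqrt_le_sqrt (by exact_mod_cast hle)).trans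
      (sqrt_sum_le_sum_sqrt T (fun j => ((h j : ℕ) : ℝ)) fun j => Nat.cast_nonneg _)
  rw [div_le_div_iff₀ (by linarith) (by linarith)]
  nlinarith [mul_le_mul_of_nonneg_right hmerge hrest]

/-- the proportional-to-square-roots allocation rule is
symmetric, strongly budget-balanced, and collusion-proof under arbitrary
reward sharing. -/
theorem sqrtRule_props :
    SymmetricRule sqrtRule ∧ StronglyBudgetBalanced sqrtRule ∧
      CollusionProofArbitrary sqrtRule :=
  ⟨symmetricRule_sqrtRule, stronglyBudgetBalanced_sqrtRule, collusionProofArbitrary_sqrtRule⟩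
end

section
/- The proportional-to-square-roots allocation rule, defined by x_i(h) = √h_i / ∑_{j=1}^n √h_j, is not sybil-proof. -/
/-- the proportional-to-square-roots allocation rule is not
sybil-proof. -/
theorem sqrtRule_not_sybilProof : ¬ SybilProof sqrtRule := by
  intro hproof
  have split : IsSybilSplit (![4, 1] : Fin 2 → ℕ+) 0 (fun _ : Fin 4 => 1) {0, 1, 2} := by
    refine ⟨⟨0, by decide⟩, ⟨fun _ => 3, ?_⟩, ?_, ?_, ?_⟩
    · have subsingleton : ∀ a b : {j : Fin 2 // j ≠ 0}, a = b := by decide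
      exact fun a b _ => subsingleton a b
    · decide
    · intro k
      have hrange : k ∈ Set.range (fun _ : {j : Fin 2 // j ≠ 0} => (3 : Fin 4)) ↔ k = 3 :=
        ⟨fun ⟨_, hk⟩ => hk.symm, fun hk => ⟨⟨1, by decide⟩, hk.symm⟩⟩
      change _ ↔ ¬ k ∈ Set.range (fun _ : {j : Fin 2 // j ≠ 0} => (3 : Fin 4))
      rw [hrange]
      revert k
      decide
    · decide
  have sqrt_four : Real.sqrt 4 = 2 := by
    rw [show (4 : ℝ) = 2 ^ 2 by norm_num, Real.sqrt_sq zero_le_two]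
  have hle := hproof two_pos _ _ _ _ split
  have card_three : ({0, 1, 2} : Finset (Fin 4)).card = 3 := rfl
  norm_num [sqrtRule, card_three, Fin.sum_univ_succ, sqrt_four] at hle
end
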